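/- Let X be a separable Banach space. Then there exist a separable Hilbert space Y and a bounded linear operator S ∈ L(X;Y) such that S is injective, the image of S is dense in Y, and S is a compact operator. -/

import Mathlib

/-- For every separable Banach space `X` there exist a separable
Hilbert space `Y` and a bounded linear operator `S : X → Y` which is injective,
has dense range, and is compact. -/
theorem exists_hilbert_compact_dense_from.{u}
    {X : Type u} [NormedAddCommGroup X] [NormedSpace ℝ X] [CompleteSpace X]
    [TopologicalSpace.SeparableSpace X] :
    ∃ (Y : Type u) (_ : NormedAddCommGroup Y) (_ : InnerProductSpace ℝ Y)
      (_ : CompleteSpace Y) (_ : TopologicalSpace.SeparableSpace Y)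
      (S : X →L[ℝ] Y),
      Function.Injective ⇑S ∧ DenseRange ⇑S ∧ IsCompactOperator ⇑S := by
  let H := lp (fun _ : ULift.{u} ℕ => ℝ) 2
  let x : ℕ → X := TopologicalSpace.denseSeq X
  have hx : DenseRange x := TopologicalSpace.denseRange_denseSeq X
  choose f hf1 hf2 using fun n => exists_dual_vector'' ℝ (x n)
  let e : ULift.{u} ℕ → H := fun n => lp.single 2 n (1:ℝ)
  have he : ∀ n, ‖e n‖ = 1 := fun n => by
    have h := lp.norm_single (E := fun _ : ULift.{u} ℕ => ℝ) (p := 2) (by norm_num) n (1 : ℝ)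
    exact h.trans norm_one
  let c : ULift.{u} ℕ → ℝ := fun n => (1/2 : ℝ) ^ n.down
  have hc : Summable c := by
    have := (Equiv.ulift.{u, 0} (α := ℕ)).summable_iff.mpr summable_geometric_two
    exact this
  let T : ULift.{u} ℕ → (X →L[ℝ] H) := fun n => c n • (f n.down).smulRight (e n)
  have hcpos : ∀ n, 0 < c n := fun n => by positivity
  have hT : Summable T := by
    refine Summable.of_norm_bounded hc fun n => ?_
    have h := ContinuousLinearMap.norm_smulRight_apply (f n.down) (e n)
    rw [he, mul_one] at h
    simp only [T]
    rw [norm_smul, h, Real.norm_of_nonneg (hcpos n).le]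
    exact mul_le_of_le_one_right (hcpos n).le (hf1 _)
  let S : X →L[ℝ] H := ∑' n, T n
  have hS : HasSum T S := hT.hasSum
  have hTc : ∀ n, IsCompactOperator (T n) := fun n => by
    have h1 : IsCompactOperator (f n.down) :=
      isCompactOperator_of_locallyCompactSpace_dom (f n.down)
    have h2 := h1.clm_comp (ContinuousLinearMap.toSpanSingleton ℝ (e n))
    exact h2.smul (c n)
  have hSc : IsCompactOperator S := by
    refine isCompactOperator_of_tendsto (F := fun s : Finset (ULift.{u} ℕ) => ∑ n ∈ s, T n) hS
      (Filter.Eventually.of_forall fun s => ?_)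
    have : ∑ n ∈ s, T n ∈ {g : X →L[ℝ] H | IsCompactOperator g} := by
      classical
      induction s using Finset.induction_on with
      | empty => simpa using isCompactOperator_zero
      | insert a s ha ih =>
        rw [Finset.sum_insert ha]
        exact (hTc a).add ih
    exact this
  have hSn : ∀ y n, inner ℝ (e n) (S y) = c n * f n.down y := fun y n => by
    have h1 : HasSum (fun m => T m y) (S y) :=
      hS.mapL (ContinuousLinearMap.apply ℝ H y)
    have h2 : HasSum (fun m => inner ℝ (e n) (T m y)) (inner ℝ (e n) (S y)) :=
      h1.mapL (innerSL ℝ (e n))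
    refine h2.unique ?_
    have h3 := hasSum_single (f := fun m => inner ℝ (e n) (T m y)) n (fun m hm => by
      have h4 : inner ℝ (e n) (e m) = 0 := by
        refine (lp.inner_single_left (𝕜 := ℝ) (G := fun _ : ULift.{u} ℕ => ℝ) n (1 : ℝ) (e m)).trans ?_
        simp only [e]
        rw [lp.single_apply_ne _ _ _ hm.symm, inner_zero_right]
      simp [T, inner_smul_right, h4])
    convert h3 using 1
    simp [T, inner_smul_right, he]
  have hinj : Function.Injective S := by
    rw [injective_iff_map_eq_zero]
    intro y hy
    have h0 : ∀ n, f n y = 0 := fun n => by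
      have := hSn y ⟨n⟩
      rw [hy, inner_zero_right] at this
      exact (mul_eq_zero.mp this.symm).resolve_left (hcpos _).ne'
    by_contra hne
    have hpos : 0 < ‖y‖ := norm_pos_iff.mpr hne
    obtain ⟨n, hn⟩ := hx.exists_dist_lt y (half_pos hpos)
    rw [dist_eq_norm] at hn
    have h1 : ‖x n‖ ≤ ‖x n - y‖ := by
      have h2 : f n (x n - y) = ‖x n‖ := by
        rw [map_sub, h0, sub_zero, hf2]; rfl
      calc ‖x n‖ = f n (x n - y) := h2.symm
        _ ≤ ‖f n (x n - y)‖ := Real.le_norm_self _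
        _ ≤ 1 * ‖x n - y‖ := (f n).le_of_opNorm_le (hf1 n) _
        _ = _ := one_mul _
    rw [norm_sub_rev] at h1
    have := norm_sub_norm_le y (x n)
    linarith
  let V : Submodule ℝ H := S.range.topologicalClosure
  have hVc : IsClosed (V : Set H) := Submodule.isClosed_topologicalClosure _
  have hmem : ∀ y, S y ∈ V := fun y => Submodule.le_topologicalClosure _ ⟨y, rfl⟩
  have hd : DenseRange (S.codRestrict V hmem) := by
    intro v
    rw [closure_subtype, ← Set.range_comp]
    exact v.2
  have hcompl : CompleteSpace V := hVc.completeSpace_coe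
  exact ⟨V, inferInstance, inferInstance, hcompl,
    hd.separableSpace (S.codRestrict V hmem).continuous, S.codRestrict V hmem,
    fun a b hab => hinj (congrArg Subtype.val hab), hd, hSc.codRestrict hmem hVc⟩
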